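/- arXiv:2012.02989 — 3 statements merged into one kernel-verified Lean document; each statement's English description precedes it below -/
import Mathlib

section
/- Let μ, ν ∈ ℝ with μ + ν > 0 and let a, b ∈ ℂ. Then for every z ∈ ℂ the series ∑_{m=0}^∞ z^m / (Γ(μm + a) · Γ(νm + b)) defining the generalized Wright function W_{(μ,a),(ν,b)}(z) is absolutely convergent (the family m ↦ z^m/(Γ(μm+a)Γ(νm+b)) is summable), so W_{(μ,a),(ν,b)} is defined on all of ℂ. -/
open Filter Topology

/-- The iterated recurrence for the reciprocal Gamma function, valid on all of `ℂ`. -/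
theorem Complex.inv_Gamma_eq_prod_mul_inv_Gamma_add_nat (s : ℂ) (n : ℕ) :
    (Complex.Gamma s)⁻¹ = (∏ j ∈ Finset.range n, (s + j)) * (Complex.Gamma (s + n))⁻¹ := by
  induction n with
  | zero => simp
  | succ n ih =>
    rw [ih, Complex.one_div_Gamma_eq_self_mul_one_div_Gamma_add_one (s + n),
      Finset.prod_range_succ]
    push_cast
    ring_nf

theorem Complex.exists_norm_inv_Gamma_le_of_norm_sub_le_one (a : ℂ) :
    ∃ M : ℝ, 0 < M ∧ ∀ w : ℂ, ‖w - a‖ ≤ 1 → ‖(Complex.Gamma w)⁻¹‖ ≤ M := by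
  obtain ⟨M, hM⟩ := (isCompact_closedBall a 1).exists_bound_of_continuousOn
    Complex.differentiable_one_div_Gamma.continuous.continuousOn
  refine ⟨max M 1, by positivity, fun w hw => (hM w ?_).trans (le_max_left _ _)⟩
  simpa [dist_eq_norm] using hw

/-- `1 / Γ(μ m + a)` is eventually at most `(C m ^ (-μ)) ^ m`, for `μ ≤ 0`. -/
theorem Complex.exists_eventually_norm_inv_Gamma_le_of_nonpos {μ : ℝ} (hμ : μ ≤ 0) (a : ℂ) :
    ∃ C : ℝ, 0 < C ∧ ∀ᶠ m : ℕ in atTop,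
      ‖(Complex.Gamma ((μ : ℂ) * m + a))⁻¹‖ ≤ (C * (m : ℝ) ^ (-μ)) ^ m := by
  obtain ⟨M, hM0, hM⟩ := Complex.exists_norm_inv_Gamma_le_of_norm_sub_le_one a
  set c : ℝ := ‖a‖ + 2 * (-μ) + 1 with hc
  have hc1 : 1 ≤ c := by have := norm_nonneg a; linarith
  have hc0 : 0 < c := by linarith
  refine ⟨(1 + M * c) * 2 * c ^ (-μ), by positivity, ?_⟩
  filter_upwards [eventually_ge_atTop 1] with m hm
  have hm1 : (1 : ℝ) ≤ m := by exact_mod_cast hm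
  set x : ℝ := -μ * m with hx
  have hx0 : 0 ≤ x := by have : 0 ≤ -μ := by linarith
                         positivity
  set N : ℕ := ⌈x⌉₊
  have hN1 : x ≤ N := Nat.le_ceil x
  have hN2 : (N : ℝ) < x + 1 := Nat.ceil_lt_add_one hx0
  set s : ℂ := (μ : ℂ) * m + a with hs
  have hsn : ‖s‖ ≤ x + ‖a‖ := by
    refine (norm_add_le _ _).trans ?_
    simp [hx, abs_of_nonpos hμ]
  have hΓ : ‖(Complex.Gamma (s + N))⁻¹‖ ≤ M := by
    apply hM
    have : s + N - a = (((N : ℝ) - x : ℝ) : ℂ) := by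
      simp only [hs, hx]; push_cast; ring
    rw [this, Complex.norm_real, Real.norm_eq_abs, abs_le]
    constructor <;> linarith
  have hprod : ‖∏ j ∈ Finset.range N, (s + (j : ℂ))‖ ≤ (c * m) ^ N := by
    rw [norm_prod]
    calc ∏ j ∈ Finset.range N, ‖s + (j : ℂ)‖ ≤ ∏ _j ∈ Finset.range N, (c * m) := by
          refine Finset.prod_le_prod (fun _ _ => norm_nonneg _) fun j hj => ?_
          have hj' : (j : ℝ) + 1 ≤ N := by exact_mod_cast Finset.mem_range.1 hj
          have : ‖s + (j : ℂ)‖ ≤ ‖s‖ + j := (norm_add_le _ _).trans (by simp)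
          have h2 : ‖a‖ ≤ ‖a‖ * m := le_mul_of_one_le_right (norm_nonneg _) hm1
          have h3 : c * m = ‖a‖ * m + 2 * x + m := by rw [hc, hx]; ring
          linarith
      _ = (c * m) ^ N := by simp
  have hcm : 1 ≤ c * m := one_le_mul_of_one_le_of_one_le hc1 hm1
  have hpow : (c * m) ^ N ≤ (c * m) * (c ^ (-μ) * (m : ℝ) ^ (-μ)) ^ m := by
    rw [← Real.rpow_natCast (c * m) N]
    calc (c * m) ^ (N : ℝ) ≤ (c * m) ^ (x + 1) :=
          Real.rpow_le_rpow_of_exponent_le hcm hN2.le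
      _ = (c * m) * ((c * m) ^ (-μ)) ^ m := by
          rw [Real.rpow_add (by linarith), Real.rpow_one, hx,
            Real.rpow_mul_natCast (by linarith)]
          ring
      _ = _ := by rw [Real.mul_rpow hc0.le (by linarith)]
  have h2m : (m : ℝ) ≤ 2 ^ m := by exact_mod_cast Nat.lt_two_pow_self.le
  have hconst : M * c ≤ (1 + M * c) ^ m := by
    have : 0 < M * c := by positivity
    have h := le_self_pow₀ (a := 1 + M * c) (by linarith) (by omega : m ≠ 0)
    linarith
  rw [Complex.inv_Gamma_eq_prod_mul_inv_Gamma_add_nat s N, norm_mul]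
  calc _ ≤ ((c * m) * (c ^ (-μ) * (m : ℝ) ^ (-μ)) ^ m) * M :=
        mul_le_mul (hprod.trans hpow) hΓ (norm_nonneg _) (by positivity)
    _ = (M * c) * m * (c ^ (-μ) * (m : ℝ) ^ (-μ)) ^ m := by ring
    _ ≤ (1 + M * c) ^ m * 2 ^ m * (c ^ (-μ) * (m : ℝ) ^ (-μ)) ^ m := by gcongr
    _ = _ := by rw [← mul_pow, ← mul_pow]; ring_nf

theorem Real.inv_factorial_floor_le {x : ℝ} (hx : 1 ≤ x) :
    ((⌊x⌋₊.factorial : ℝ))⁻¹ ≤ Real.exp 1 * Real.exp (2 * x) * x ^ (-x) := by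
  set N : ℕ := ⌊x⌋₊
  have hN1 : (N : ℝ) ≤ x := Nat.floor_le (by linarith)
  have hN2 : x < N + 1 := Nat.lt_floor_add_one x
  have hpow : x ^ x ≤ ((N : ℝ) + 1) ^ (N + 1) := by
    calc x ^ x ≤ x ^ ((N + 1 : ℕ) : ℝ) :=
          Real.rpow_le_rpow_of_exponent_le hx (by push_cast; exact hN2.le)
      _ = x ^ (N + 1) := Real.rpow_natCast _ _
      _ ≤ _ := by gcongr
  have hexp : ((N : ℝ) + 1) ^ (N + 1) ≤ (N + 1) * N.factorial * Real.exp (N + 1) := by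
    have h := Real.pow_div_factorial_le_exp ((N : ℝ) + 1) (by positivity) (N + 1)
    rw [div_le_iff₀ (by positivity), Nat.factorial_succ] at h
    push_cast at h
    linarith
  have hlin : (N : ℝ) + 1 ≤ Real.exp x := (by linarith : (N : ℝ) + 1 ≤ x + 1).trans
    (Real.add_one_le_exp x)
  have hmono : Real.exp (N + 1) ≤ Real.exp (x + 1) := Real.exp_le_exp.2 (by linarith)
  rw [Real.rpow_neg (by linarith), ← div_eq_mul_inv, le_div_iff₀ (by positivity),
    inv_mul_le_iff₀ (by positivity)]
  calc x ^ x ≤ (N + 1) * N.factorial * Real.exp (N + 1) := hpow.trans hexp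
    _ ≤ Real.exp x * N.factorial * Real.exp (x + 1) := by gcongr
    _ = _ := by rw [Real.exp_add, two_mul, Real.exp_add]; ring

/-- `1 / Γ(μ m + a)` is eventually at most `(C m ^ (-μ)) ^ m`, for `μ > 0` and `Re a ≥ 1`. -/
theorem Complex.exists_eventually_norm_inv_Gamma_le_of_pos_of_one_le_re {μ : ℝ} (hμ : 0 < μ)
    {a : ℂ} (ha : 1 ≤ a.re) :
    ∃ C : ℝ, 0 < C ∧ ∀ᶠ m : ℕ in atTop,
      ‖(Complex.Gamma ((μ : ℂ) * m + a))⁻¹‖ ≤ (C * (m : ℝ) ^ (-μ)) ^ m := by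
  obtain ⟨M, hM0, hM⟩ := Complex.exists_norm_inv_Gamma_le_of_norm_sub_le_one a
  refine ⟨(1 + M * Real.exp 1) * Real.exp (2 * μ) * μ ^ (-μ), by positivity, ?_⟩
  filter_upwards [eventually_ge_atTop 1, eventually_ge_atTop ⌈μ⁻¹⌉₊] with m hm hmμ
  set x : ℝ := μ * m with hx
  have hx1 : 1 ≤ x := by
    have := Nat.ceil_le.1 hmμ
    rwa [inv_le_iff_one_le_mul₀' hμ] at this
  set N : ℕ := ⌊x⌋₊
  have hN1 : (N : ℝ) ≤ x := Nat.floor_le (by linarith)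
  have hN2 : x < N + 1 := Nat.lt_floor_add_one x
  set w : ℂ := ((x - N : ℝ) : ℂ) + a with hw
  have hΓ : ‖(Complex.Gamma w)⁻¹‖ ≤ M := by
    apply hM
    rw [hw, add_sub_cancel_right, Complex.norm_real, Real.norm_eq_abs, abs_le]
    constructor <;> linarith
  have hprod : (N.factorial : ℝ) ≤ ‖∏ j ∈ Finset.range N, (w + (j : ℂ))‖ := by
    rw [norm_prod, ← Finset.prod_range_add_one_eq_factorial]
    push_cast
    refine Finset.prod_le_prod (fun _ _ => by positivity) fun j _ => ?_
    refine le_trans ?_ (Complex.re_le_norm _)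
    simp only [hw, Complex.add_re, Complex.ofReal_re, Complex.natCast_re]
    linarith
  have hrec := congrArg norm (Complex.inv_Gamma_eq_prod_mul_inv_Gamma_add_nat w N)
  have hwN : w + N = (μ : ℂ) * m + a := by simp only [hw, hx]; push_cast; ring
  rw [norm_mul, hwN] at hrec
  have hfac : ‖(Complex.Gamma ((μ : ℂ) * m + a))⁻¹‖ ≤ M * (N.factorial : ℝ)⁻¹ := by
    rw [← div_eq_mul_inv, le_div_iff₀ (by positivity), mul_comm]
    refine le_trans ?_ (hrec.symm.le.trans hΓ)
    gcongr
  have hconst : M * Real.exp 1 ≤ (1 + M * Real.exp 1) ^ m := by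
    have : 0 < M * Real.exp 1 := by positivity
    have h := le_self_pow₀ (a := 1 + M * Real.exp 1) (by linarith) (by omega : m ≠ 0)
    linarith
  have hxx : x ^ (-x) = (μ ^ (-μ) * (m : ℝ) ^ (-μ)) ^ m := by
    rw [← Real.mul_rpow hμ.le (by positivity), ← hx, ← Real.rpow_mul_natCast (by linarith)]
    congr 1
    rw [hx]; ring
  have hee : Real.exp (2 * x) = Real.exp (2 * μ) ^ m := by
    rw [← Real.exp_nat_mul, hx]; ring_nf
  calc _ ≤ M * (Real.exp 1 * Real.exp (2 * x) * x ^ (-x)) :=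
        hfac.trans (by gcongr; exact Real.inv_factorial_floor_le hx1)
    _ = (M * Real.exp 1) * Real.exp (2 * μ) ^ m * (μ ^ (-μ) * (m : ℝ) ^ (-μ)) ^ m := by
        rw [hxx, hee]; ring
    _ ≤ (1 + M * Real.exp 1) ^ m * Real.exp (2 * μ) ^ m * (μ ^ (-μ) * (m : ℝ) ^ (-μ)) ^ m := by
        gcongr
    _ = _ := by rw [← mul_pow, ← mul_pow]; ring_nf

/-- If the bound `(C m ^ (-μ)) ^ m` holds for `1 / Γ(μ m + a + 1)`, it holds for `1 / Γ(μ m + a)`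
with another constant. -/
theorem Complex.exists_eventually_norm_inv_Gamma_le_of_add_one {μ : ℝ} {a : ℂ}
    (h : ∃ C : ℝ, 0 < C ∧ ∀ᶠ m : ℕ in atTop,
      ‖(Complex.Gamma ((μ : ℂ) * m + (a + 1)))⁻¹‖ ≤ (C * (m : ℝ) ^ (-μ)) ^ m) :
    ∃ C : ℝ, 0 < C ∧ ∀ᶠ m : ℕ in atTop,
      ‖(Complex.Gamma ((μ : ℂ) * m + a))⁻¹‖ ≤ (C * (m : ℝ) ^ (-μ)) ^ m := by
  obtain ⟨C, hC, h⟩ := h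
  refine ⟨(1 + (|μ| + ‖a‖)) * 2 * C, by positivity, ?_⟩
  filter_upwards [h, eventually_ge_atTop 1] with m h hm
  have hm1 : (1 : ℝ) ≤ m := by exact_mod_cast hm
  have h2m : (m : ℝ) ≤ 2 ^ m := by exact_mod_cast Nat.lt_two_pow_self.le
  have hlin : ‖(μ : ℂ) * m + a‖ ≤ (1 + (|μ| + ‖a‖)) ^ m * 2 ^ m := by
    calc ‖(μ : ℂ) * m + a‖ ≤ |μ| * m + ‖a‖ := (norm_add_le _ _).trans (by simp)
      _ ≤ (1 + (|μ| + ‖a‖)) * m := by nlinarith [norm_nonneg a]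
      _ ≤ _ := by
        gcongr
        exact le_self_pow₀ (by linarith [norm_nonneg a, abs_nonneg μ]) (by omega)
  rw [Complex.one_div_Gamma_eq_self_mul_one_div_Gamma_add_one, norm_mul, add_assoc]
  calc _ ≤ (1 + (|μ| + ‖a‖)) ^ m * 2 ^ m * (C * (m : ℝ) ^ (-μ)) ^ m := by gcongr
    _ = _ := by rw [← mul_pow, ← mul_pow]; ring_nf

/-- Along `m ↦ μ m + a`, the reciprocal Gamma function is eventually at most `(C m ^ (-μ)) ^ m`. -/
theorem Complex.exists_eventually_norm_inv_Gamma_le (μ : ℝ) (a : ℂ) :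
    ∃ C : ℝ, 0 < C ∧ ∀ᶠ m : ℕ in atTop,
      ‖(Complex.Gamma ((μ : ℂ) * m + a))⁻¹‖ ≤ (C * (m : ℝ) ^ (-μ)) ^ m := by
  rcases le_or_gt μ 0 with hμ | hμ
  · exact Complex.exists_eventually_norm_inv_Gamma_le_of_nonpos hμ a
  · obtain ⟨k, hk⟩ := exists_nat_ge (1 - a.re)
    induction k generalizing a with
    | zero =>
      exact Complex.exists_eventually_norm_inv_Gamma_le_of_pos_of_one_le_re hμ
        (by simpa using hk)
    | succ k ih =>
      refine Complex.exists_eventually_norm_inv_Gamma_le_of_add_one (ih (a + 1) ?_)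
      push_cast at hk
      simp only [Complex.add_re, Complex.one_re]
      linarith

/-- The generalized Wright function `W_{(μ,a),(ν,b)}(z) = ∑ z^m / (Γ(μm+a) Γ(νm+b))`
is defined by an absolutely convergent series on all of ℂ when `μ + ν > 0`.
(Mathlib's `Complex.Gamma` vanishes at the poles, so division provides the
convention `1/Γ = 0` at the poles.) -/
theorem generalized_wright_summable (μ ν : ℝ) (hμν : μ + ν > 0) (a b : ℂ) (z : ℂ) :
    Summable (fun m : ℕ =>
      z ^ m / (Complex.Gamma ((μ : ℂ) * m + a) * Complex.Gamma ((ν : ℂ) * m + b))) := by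
  obtain ⟨C, hC, hA⟩ := Complex.exists_eventually_norm_inv_Gamma_le μ a
  obtain ⟨D, hD, hB⟩ := Complex.exists_eventually_norm_inv_Gamma_le ν b
  have hlim : Tendsto (fun m : ℕ => ‖z‖ * C * D * (m : ℝ) ^ (-(μ + ν))) atTop (𝓝 0) := by
    simpa using ((tendsto_rpow_neg_atTop hμν).comp tendsto_natCast_atTop_atTop).const_mul
      (‖z‖ * C * D)
  refine Summable.of_norm_bounded_eventually_nat (g := fun m : ℕ => (1 / 2 : ℝ) ^ m)
    summable_geometric_two ?_
  filter_upwards [hA, hB, hlim.eventually_le_const (by norm_num : (0 : ℝ) < 1 / 2),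
    eventually_ge_atTop 1] with m hA hB hsmall hm
  have hm0 : (0 : ℝ) < m := by exact_mod_cast hm
  rw [div_eq_mul_inv, mul_inv, norm_mul, norm_mul, norm_pow]
  calc _ ≤ ‖z‖ ^ m * ((C * (m : ℝ) ^ (-μ)) ^ m * (D * (m : ℝ) ^ (-ν)) ^ m) := by gcongr
    _ = (‖z‖ * C * D * (m : ℝ) ^ (-(μ + ν))) ^ m := by
        rw [neg_add, Real.rpow_add hm0, ← mul_pow, ← mul_pow]; ring_nf
    _ ≤ _ := by gcongr
end

section
/- Let σ ∈ ℝ with 0 < σ < 1, let b ∈ ℝ, c ∈ ℂ, ξ ∈ ℝ, y > 0, and s ∈ ℕ. Then the s-th derivative with respect to x of the function x ↦ y^b φ(−σ, b+1, c(x−ξ)y^{−σ}) equals c^s y^{b−σs} φ(−σ, b+1−σs, c(x−ξ)y^{−σ}) for every x ∈ ℝ. -/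
/-- The Wright function `φ(-σ, ε, z) = ∑ z^k/(k! Γ(-σk+ε))`. -/
noncomputable def wrightPhi (σ ε : ℝ) (z : ℂ) : ℂ :=
  ∑' m : ℕ, z ^ m / ((m.factorial : ℂ) * Complex.Gamma (-(σ : ℂ) * m + (ε : ℂ)))

open Filter Topology

lemma abs_inv_Gamma_le_Gamma_one_sub {x : ℝ} (hx : 0 < 1 - x) :
    |(Real.Gamma x)⁻¹| ≤ Real.Gamma (1 - x) := by
  have hG : 0 < Real.Gamma (1 - x) := Real.Gamma_pos_of_pos hx
  have hrefl := Real.Gamma_mul_Gamma_one_sub x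
  by_cases h0 : Real.Gamma x = 0
  · simpa [h0] using hG.le
  · have hsin : Real.sin (Real.pi * x) ≠ 0 := by
      intro h
      rw [h, div_zero] at hrefl
      exact (mul_ne_zero h0 hG.ne') hrefl
    have hinv : (Real.Gamma x)⁻¹ = Real.Gamma (1 - x) * (Real.sin (Real.pi * x) / Real.pi) := by
      rw [eq_div_iff hsin] at hrefl
      refine inv_eq_of_mul_eq_one_right ?_
      rw [← mul_assoc, ← mul_div_assoc, hrefl, div_self Real.pi_ne_zero]
    rw [hinv, abs_mul, abs_of_pos hG, abs_div, abs_of_pos Real.pi_pos]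
    refine mul_le_of_le_one_right hG.le ?_
    rw [div_le_one Real.pi_pos]
    linarith [Real.abs_sin_le_one (Real.pi * x), Real.pi_gt_three]

lemma summable_pow_mul_factorial_rpow_neg {τ : ℝ} (hτ : 0 < τ) (R : ℝ) :
    Summable fun k : ℕ => R ^ k * (k.factorial : ℝ) ^ (-τ) := by
  by_cases hR : R = 0
  · subst hR
    refine summable_of_ne_finset_zero (s := {0}) fun k hk => ?_
    rw [zero_pow (by simpa using hk), zero_mul]
  have hpos : ∀ k : ℕ, 0 < (k.factorial : ℝ) := fun k => by positivity
  refine summable_of_ratio_test_tendsto_lt_one zero_lt_one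
    (.of_forall fun k => mul_ne_zero (pow_ne_zero _ hR) (Real.rpow_pos_of_pos (hpos k) _).ne') ?_
  have hratio : ∀ k : ℕ, ‖R ^ (k + 1) * ((k + 1).factorial : ℝ) ^ (-τ)‖ /
      ‖R ^ k * (k.factorial : ℝ) ^ (-τ)‖ = |R| * ((k + 1 : ℕ) : ℝ) ^ (-τ) := fun k => by
    have h1 : 0 < (k.factorial : ℝ) ^ (-τ) := Real.rpow_pos_of_pos (hpos k) _
    have h2 : 0 < ((k + 1 : ℕ) : ℝ) ^ (-τ) := Real.rpow_pos_of_pos (by positivity) _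
    have h3 : |R| ≠ 0 := abs_ne_zero.mpr hR
    rw [Nat.factorial_succ, Nat.cast_mul, Real.mul_rpow (by positivity) (by positivity)]
    simp only [norm_mul, norm_pow, Real.norm_eq_abs, abs_of_pos h1, abs_of_pos h2]
    field_simp
    ring
  simp_rw [hratio]
  have hlim := ((tendsto_rpow_neg_atTop hτ).comp
    (tendsto_natCast_atTop_atTop.comp (tendsto_add_atTop_nat 1))).const_mul |R|
  simpa using hlim

/-- Hölder bound for `Γ` along an arithmetic progression of step less than one. -/
lemma eventually_Gamma_mul_add_le {σ : ℝ} (hσ1 : 0 < σ) (hσ2 : σ < 1) (a : ℝ) :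
    ∃ C : ℝ, ∀ᶠ k : ℕ in atTop,
      0 < σ * k + a ∧ Real.Gamma (σ * k + a) ≤ (k.factorial : ℝ) ^ σ * C := by
  have hτ : 0 < 1 - σ := by linarith
  set v : ℝ := (max a 1 - σ) / (1 - σ) with hv
  have hvpos : 0 < v := div_pos (by linarith [le_max_right a 1]) hτ
  refine ⟨Real.Gamma v ^ (1 - σ), ?_⟩
  have hlim : Tendsto (fun k : ℕ => σ * (k : ℝ) + a) atTop atTop :=
    tendsto_atTop_add_const_right _ _ (tendsto_natCast_atTop_atTop.const_mul_atTop hσ1)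
  filter_upwards [hlim.eventually_ge_atTop 2] with k hk
  refine ⟨by linarith, ?_⟩
  have hle : σ * (k : ℝ) + a ≤ σ * k + max a 1 := by gcongr; exact le_max_left _ _
  have hEq : σ * (k : ℝ) + max a 1 = σ * (k + 1) + (1 - σ) * v := by
    rw [hv]; field_simp; ring
  calc Real.Gamma (σ * k + a) ≤ Real.Gamma (σ * k + max a 1) :=
        Real.Gamma_strictMonoOn_Ici.monotoneOn hk (hk.trans hle) hle
    _ ≤ Real.Gamma (k + 1) ^ σ * Real.Gamma v ^ (1 - σ) := by
        rw [hEq]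
        exact Real.Gamma_mul_add_mul_le_rpow_Gamma_mul_rpow_Gamma (by positivity) hvpos hσ1 hτ
          (by ring)
    _ = _ := by rw [Real.Gamma_nat_eq_factorial]

lemma summable_norm_wrightPhi_coeff {σ : ℝ} (hσ1 : 0 < σ) (hσ2 : σ < 1) (ε : ℝ) {R : ℝ}
    (hR : 0 ≤ R) :
    Summable fun m : ℕ =>
      R ^ m / ‖(m.factorial : ℂ) * Complex.Gamma (-(σ : ℂ) * m + (ε : ℂ))‖ := by
  obtain ⟨C, hC⟩ := eventually_Gamma_mul_add_le hσ1 hσ2 (1 - ε)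
  refine Summable.of_norm_bounded_eventually_nat
    ((summable_pow_mul_factorial_rpow_neg (sub_pos.mpr hσ2) R).mul_right C) ?_
  filter_upwards [hC] with m hm
  have hfac : 0 < (m.factorial : ℝ) := by positivity
  have hcast : -(σ : ℂ) * m + (ε : ℂ) = ((-σ * m + ε : ℝ) : ℂ) := by push_cast; ring
  have harg : σ * m + (1 - ε) = 1 - (-σ * m + ε) := by ring
  rw [harg] at hm
  have hG := (abs_inv_Gamma_le_Gamma_one_sub hm.1).trans hm.2
  rw [Real.norm_of_nonneg (by positivity), norm_mul, hcast, Complex.Gamma_ofReal,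
    Complex.norm_natCast, Complex.norm_real, Real.norm_eq_abs]
  calc R ^ m / (m.factorial * |Real.Gamma (-σ * m + ε)|)
      = R ^ m * (m.factorial : ℝ)⁻¹ * |(Real.Gamma (-σ * m + ε))⁻¹| := by
        rw [abs_inv, div_eq_mul_inv, mul_inv, mul_assoc]
    _ ≤ R ^ m * (m.factorial : ℝ)⁻¹ * ((m.factorial : ℝ) ^ σ * C) := by gcongr
    _ = R ^ m * (m.factorial : ℝ) ^ (-(1 - σ)) * C := by
        rw [show -(1 - σ) = -1 + σ by ring, Real.rpow_add hfac, Real.rpow_neg_one]; ring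

lemma hasDerivAt_wrightPhi {σ : ℝ} (hσ1 : 0 < σ) (hσ2 : σ < 1) (ε : ℝ) (z : ℂ) :
    HasDerivAt (wrightPhi σ ε) (wrightPhi σ (ε - σ) z) z := by
  set d : ℕ → ℂ := fun m => (m.factorial : ℂ) * Complex.Gamma (-(σ : ℂ) * m + (ε : ℂ)) with hd
  set R : ℝ := ‖z‖ + 1
  have hR : 0 ≤ R := by positivity
  have hshift : ∀ (m : ℕ), d (m + 1) = ((m + 1 : ℕ) : ℂ) *
      ((m.factorial : ℂ) * Complex.Gamma (-(σ : ℂ) * m + ((ε - σ : ℝ) : ℂ))) := fun m => by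
    simp only [hd, Nat.factorial_succ]
    rw [show -(σ : ℂ) * ((m + 1 : ℕ) : ℂ) + ε = -(σ : ℂ) * m + ((ε - σ : ℝ) : ℂ) by
      push_cast; ring]
    push_cast
    ring
  have hterm : ∀ (m : ℕ) (w : ℂ), ((m + 1 : ℕ) : ℂ) * w ^ m / d (m + 1) =
      w ^ m / ((m.factorial : ℂ) * Complex.Gamma (-(σ : ℂ) * m + ((ε - σ : ℝ) : ℂ))) :=
    fun m w => by
      rw [hshift, mul_div_mul_left _ _ (Nat.cast_ne_zero.mpr m.succ_ne_zero)]
  have hu : Summable fun m : ℕ => m * R ^ (m - 1) / ‖d m‖ := by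
    rw [← summable_nat_add_iff 1]
    refine (summable_norm_wrightPhi_coeff hσ1 hσ2 (ε - σ) hR).congr fun m => ?_
    have h := congrArg norm (hterm m (R : ℂ))
    simp only [norm_div, norm_mul, norm_pow, Complex.norm_natCast, Complex.norm_real,
      Real.norm_of_nonneg hR] at h ⊢
    simpa using h.symm
  have hsum : Summable fun m : ℕ => z ^ m / d m :=
    .of_norm <| (summable_norm_wrightPhi_coeff hσ1 hσ2 ε (norm_nonneg z)).congr fun m => by
      rw [norm_div, norm_pow]
  have hz : z ∈ Metric.ball (0 : ℂ) R := by simp [R]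
  have hbound : ∀ (m : ℕ) (w : ℂ), w ∈ Metric.ball (0 : ℂ) R →
      ‖m * w ^ (m - 1) / d m‖ ≤ m * R ^ (m - 1) / ‖d m‖ := fun m w hw => by
    have hw' : ‖w‖ ≤ R := (mem_ball_zero_iff.mp hw).le
    rw [norm_div, norm_mul, norm_pow, Complex.norm_natCast]
    gcongr
  have hderiv := hasDerivAt_tsum_of_isPreconnected hu Metric.isOpen_ball
    (convex_ball (0 : ℂ) R).isPreconnected
    (fun m w _ => (hasDerivAt_pow m w).div_const (d m)) hbound hz hsum hz
  have hval : ∑' m : ℕ, m * z ^ (m - 1) / d m = wrightPhi σ (ε - σ) z := by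
    rw [(Summable.of_norm_bounded hu fun m => hbound m z hz).tsum_eq_zero_add]
    simpa [wrightPhi] using tsum_congr fun m => hterm m z
  rw [hval] at hderiv
  exact hderiv

/-- The `s`-th derivative in `x` of `y^b φ(-σ, b+1, c(x-ξ)y^{-σ})` is
`c^s y^{b-σs} φ(-σ, b+1-σs, c(x-ξ)y^{-σ})`. -/
theorem wright_iteratedDeriv (σ : ℝ) (hσ1 : 0 < σ) (hσ2 : σ < 1) (b : ℝ) (c : ℂ)
    (ξ y : ℝ) (hy : 0 < y) (s : ℕ) (x : ℝ) :
    iteratedDeriv s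
      (fun t : ℝ =>
        ((y ^ b : ℝ) : ℂ) * wrightPhi σ (b + 1) (c * ((t - ξ : ℝ) : ℂ) * ((y ^ (-σ) : ℝ) : ℂ))) x
    = c ^ s * ((y ^ (b - σ * s) : ℝ) : ℂ) *
        wrightPhi σ (b + 1 - σ * s) (c * ((x - ξ : ℝ) : ℂ) * ((y ^ (-σ) : ℝ) : ℂ)) := by
  induction s generalizing x with
  | zero => simp
  | succ s ih =>
    rw [iteratedDeriv_succ, funext ih]
    have hinner : HasDerivAt (fun t : ℝ => c * ((t - ξ : ℝ) : ℂ) * ((y ^ (-σ) : ℝ) : ℂ))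
        (c * ((1 : ℝ) : ℂ) * ((y ^ (-σ) : ℝ) : ℂ)) x :=
      ((((hasDerivAt_id x).sub_const ξ).ofReal_comp).const_mul c).mul_const _
    have hcomp := ((hasDerivAt_wrightPhi hσ1 hσ2 (b + 1 - σ * s) _).comp x hinner).const_mul
      (c ^ s * ((y ^ (b - σ * s) : ℝ) : ℂ))
    refine hcomp.deriv.trans ?_
    rw [show b + 1 - σ * ((s + 1 : ℕ) : ℝ) = b + 1 - σ * s - σ by push_cast; ring,
      show b - σ * ((s + 1 : ℕ) : ℝ) = (b - σ * s) + -σ by push_cast; ring, Real.rpow_add hy]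
    push_cast
    ring
end

section
/- Let n ∈ ℕ, n ≥ 2, 1 < α < 2, σ = α/(2n), k ∈ {0,…,n−1}, θ_k = (n−1−2k)π/(2n), and ε ∈ ℝ. Then the improper integral ∫_0^∞ φ(−σ, ε, −e^{iθ_k} t) dt converges and e^{iθ_k} ∫_0^∞ φ(−σ, ε, −e^{iθ_k} t) dt = 1/Γ(ε + σ). -/
/-- The angles `θ_k = (n-1-2k)π/(2n)`. -/
noncomputable def thetaK (n k : ℕ) : ℝ := (((n : ℝ) - 1 - 2 * (k : ℝ)) * Real.pi) / (2 * (n : ℝ))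

namespace Wright

open MeasureTheory Filter Topology Set

/-- The integrand `exp (exp w + (1 - x) w)` of the Hankel integral for `1 / Γ(x)`, in the
logarithmic coordinate `w = log s`. -/
noncomputable def hankelKernel (x : ℝ) (w : ℂ) : ℂ := Complex.exp (Complex.exp w + (1 - x) * w)

/-- The integral of `f` along the contour coming from `+∞ - iφ`, going up along the imaginary axis
from `-iφ` to `iφ`, and leaving towards `+∞ + iφ`. -/
noncomputable def hankelIntegral (φ : ℝ) (f : ℂ → ℂ) : ℂ :=
  Complex.I * (∫ y in Icc (-φ) φ, f (y * Complex.I)) +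
    (∫ r in Ioi (0 : ℝ), f (r + φ * Complex.I)) -
    ∫ r in Ioi (0 : ℝ), f (r + (-φ : ℝ) * Complex.I)

lemma exp_image_univ : Real.exp '' univ = Ioi 0 := by
  rw [image_univ, Real.range_exp]

lemma integrable_exp_neg_mul_exp {c y : ℝ} (hc : 0 < c) (hy : 0 < y) :
    Integrable (fun r : ℝ => Real.exp (-c * Real.exp r + y * r)) := by
  have h1 := integrableOn_rpow_mul_exp_neg_mul_rpow (p := 1) (s := y - 1) (by linarith) one_pos hc
  rw [← exp_image_univ, integrableOn_image_iff_integrableOn_abs_deriv_smul MeasurableSet.univ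
    (fun x _ => (Real.hasDerivAt_exp x).hasDerivWithinAt) Real.exp_injective.injOn,
    integrableOn_univ] at h1
  refine h1.congr (ae_of_all _ fun r => ?_)
  simp only [Real.rpow_one, smul_eq_mul, abs_of_pos (Real.exp_pos r), ← Real.exp_mul,
    ← Real.exp_add]
  ring_nf

lemma integral_exp_neg_exp {y : ℝ} (hy : 0 < y) :
    ∫ r : ℝ, Real.exp (-Real.exp r + y * r) = Real.Gamma y := by
  rw [Real.Gamma_eq_integral hy, ← exp_image_univ,
    integral_image_eq_integral_abs_deriv_smul MeasurableSet.univ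
    (fun x _ => (Real.hasDerivAt_exp x).hasDerivWithinAt) Real.exp_injective.injOn,
    Measure.restrict_univ]
  congr 1
  ext r
  simp only [smul_eq_mul, abs_of_pos (Real.exp_pos r), ← Real.exp_mul, ← Real.exp_add]
  ring_nf

lemma tendsto_exp_neg_mul_exp_atTop {c : ℝ} (hc : 0 < c) (y : ℝ) :
    Tendsto (fun r : ℝ => Real.exp (-c * Real.exp r + y * r)) atTop (𝓝 0) := by
  have h := (tendsto_rpow_mul_exp_neg_mul_atTop_nhds_zero y c hc).comp Real.tendsto_exp_atTop
  refine h.congr fun r => ?_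
  simp only [Function.comp, ← Real.exp_mul, ← Real.exp_add]
  ring_nf

lemma tendsto_exp_neg_mul_exp_atBot {y : ℝ} (hy : 0 < y) (c : ℝ) :
    Tendsto (fun r : ℝ => Real.exp (-c * Real.exp r + y * r)) atBot (𝓝 0) := by
  refine Real.tendsto_exp_atBot.comp ?_
  have h1 : Tendsto (fun r : ℝ => -c * Real.exp r) atBot (𝓝 (-c * 0)) :=
    Real.tendsto_exp_atBot.const_mul _
  exact h1.add_atBot (tendsto_id.const_mul_atBot hy)

lemma norm_hankelKernel (x : ℝ) (w : ℂ) :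
    ‖hankelKernel x w‖ = Real.exp ((Complex.exp w).re + (1 - x) * w.re) := by
  simp [hankelKernel, Complex.norm_exp]

lemma norm_hankelKernel_add_mul_I (x r y : ℝ) :
    ‖hankelKernel x (r + y * Complex.I)‖ = Real.exp (Real.exp r * Real.cos y + (1 - x) * r) := by
  rw [norm_hankelKernel, Complex.exp_re]
  simp

lemma differentiable_hankelKernel (x : ℝ) : Differentiable ℂ (hankelKernel x) := by
  unfold hankelKernel; fun_prop

@[fun_prop]
lemma continuous_hankelKernel (x : ℝ) : Continuous (hankelKernel x) :=
  (differentiable_hankelKernel x).continuous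

lemma norm_hankelKernel_le {x c y : ℝ} (h : Real.cos y ≤ -c) (r : ℝ) :
    ‖hankelKernel x (r + y * Complex.I)‖ ≤ Real.exp (-c * Real.exp r + (1 - x) * r) := by
  rw [norm_hankelKernel_add_mul_I, mul_comm]
  gcongr

lemma integrable_hankelKernel {x y : ℝ} (hx : x < 1) (hy : Real.cos y < 0) :
    Integrable (fun r : ℝ => hankelKernel x (r + y * Complex.I)) := by
  refine (integrable_exp_neg_mul_exp (c := -Real.cos y) (y := 1 - x) (by linarith)
    (by linarith)).mono' (by fun_prop) (ae_of_all _ fun r => norm_hankelKernel_le (by simp) r)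

lemma rect_hankelKernel (x a b R S : ℝ) :
    (∫ r in R..S, hankelKernel x (r + a * Complex.I)) -
      (∫ r in R..S, hankelKernel x (r + b * Complex.I)) +
      Complex.I * (∫ y in a..b, hankelKernel x (S + y * Complex.I)) -
      Complex.I * (∫ y in a..b, hankelKernel x (R + y * Complex.I)) = 0 := by
  simpa using Complex.integral_boundary_rect_eq_zero_of_differentiableOn (hankelKernel x)
    (R + a * Complex.I) (S + b * Complex.I) (differentiable_hankelKernel x).differentiableOn

lemma tendsto_vertical_edge_hankelKernel {ι : Type*} {l : Filter ι} {ρ : ι → ℝ} {x c a b : ℝ}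
    (hab : ∀ y ∈ uIoc a b, Real.cos y ≤ -c)
    (h : Tendsto (fun i => Real.exp (-c * Real.exp (ρ i) + (1 - x) * ρ i)) l (𝓝 0)) :
    Tendsto (fun i => Complex.I * (∫ y in a..b, hankelKernel x (ρ i + y * Complex.I))) l (𝓝 0) := by
  refine squeeze_zero_norm (fun i => ?_) (by simpa using h.mul_const |b - a|)
  rw [norm_mul, Complex.norm_I, one_mul]
  exact intervalIntegral.norm_integral_le_of_norm_le_const fun y hy => by
    simpa using norm_hankelKernel_le (x := x) (hab y hy) (ρ i)

lemma integral_line_hankelKernel_eq {x c a b : ℝ} (hx : x < 1) (hc : 0 < c)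
    (hab : ∀ y ∈ uIcc a b, Real.cos y ≤ -c) :
    ∫ r : ℝ, hankelKernel x (r + a * Complex.I) = ∫ r : ℝ, hankelKernel x (r + b * Complex.I) := by
  have hab' : ∀ y ∈ uIoc a b, Real.cos y ≤ -c := fun y hy => hab y (uIoc_subset_uIcc hy)
  have ha : Real.cos a < 0 := (hab a left_mem_uIcc).trans_lt (by linarith)
  have hb : Real.cos b < 0 := (hab b right_mem_uIcc).trans_lt (by linarith)
  have hl := intervalIntegral_tendsto_integral (integrable_hankelKernel hx ha)
    tendsto_neg_atTop_atBot tendsto_id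
  have hr := intervalIntegral_tendsto_integral (integrable_hankelKernel hx hb)
    tendsto_neg_atTop_atBot tendsto_id
  have hS := tendsto_vertical_edge_hankelKernel (x := x) hab' (tendsto_exp_neg_mul_exp_atTop hc (1 - x))
  have hR := tendsto_vertical_edge_hankelKernel (x := x) hab' ((tendsto_exp_neg_mul_exp_atBot (by linarith) c).comp
    tendsto_neg_atTop_atBot)
  have := tendsto_nhds_unique (((hl.sub hr).add hS).sub hR)
    (tendsto_const_nhds.congr fun R => (rect_hankelKernel x a b (-R) R).symm)
  rw [add_zero, sub_zero] at this
  exact sub_eq_zero.1 this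

lemma hankelIntegral_eq_sub_integral_line {x φ : ℝ} (hx : x < 1) (hφ : 0 ≤ φ) (hc : Real.cos φ < 0) :
    hankelIntegral φ (hankelKernel x) = (∫ r : ℝ, hankelKernel x (r + φ * Complex.I)) -
      ∫ r : ℝ, hankelKernel x (r + (-φ : ℝ) * Complex.I) := by
  have hi := integrable_hankelKernel hx hc
  have hi' := integrable_hankelKernel (y := -φ) hx (by simpa using hc)
  have hl := intervalIntegral_tendsto_integral_Iic 0 hi'.integrableOn tendsto_neg_atTop_atBot
  have hr := intervalIntegral_tendsto_integral_Iic 0 hi.integrableOn tendsto_neg_atTop_atBot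
  have hR := tendsto_vertical_edge_hankelKernel (x := x) (c := -1) (a := -φ) (b := φ)
    (fun y _ => by simpa using Real.cos_le_one y)
    ((tendsto_exp_neg_mul_exp_atBot (by linarith) (-1)).comp tendsto_neg_atTop_atBot)
  have := tendsto_nhds_unique (((hl.sub hr).add_const
    (Complex.I * (∫ y in -φ..φ, hankelKernel x ((0 : ℝ) + y * Complex.I)))).sub hR)
    (tendsto_const_nhds.congr fun R => (rect_hankelKernel x (-φ) φ (-R) 0).symm)
  rw [← intervalIntegral.integral_Iic_add_Ioi hi.integrableOn hi.integrableOn (b := 0),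
    ← intervalIntegral.integral_Iic_add_Ioi hi'.integrableOn hi'.integrableOn (b := 0),
    hankelIntegral, integral_Icc_eq_integral_Ioc, ← intervalIntegral.integral_of_le (by linarith)]
  simp only [Complex.ofReal_zero, zero_add, sub_zero] at this
  linear_combination this

lemma integral_line_of_exp_eq {x b : ℝ} (hx : x < 1) (hb : Complex.exp (b * Complex.I) = -1) :
    ∫ r : ℝ, hankelKernel x (r + b * Complex.I) =
      Complex.exp ((1 - x) * (b * Complex.I)) * Complex.Gamma (1 - x) := by
  have h := integral_exp_neg_exp (y := 1 - x) (by linarith)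
  have h' := congrArg (Complex.ofReal) h
  rw [← integral_complex_ofReal, ← Complex.Gamma_ofReal] at h'
  push_cast at h'
  rw [← h', ← integral_const_mul]
  congr 1
  ext r
  rw [hankelKernel, Complex.exp_add r, hb, ← Complex.exp_add]
  ring_nf

lemma hankelIntegral_of_lt_one {x φ : ℝ} (hx : x < 1) (h1 : Real.pi / 2 < φ) (h2 : φ < Real.pi) :
    hankelIntegral φ (hankelKernel x) = 2 * Real.pi * Complex.I * (Complex.Gamma x)⁻¹ := by
  have hπ := Real.pi_pos
  have hc : Real.cos φ < 0 := Real.cos_neg_of_pi_div_two_lt_of_lt h1 (by linarith)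
  have hcos : ∀ y ∈ Icc φ Real.pi, Real.cos y ≤ - -Real.cos φ := fun y hy => by
    rw [neg_neg]; exact Real.cos_le_cos_of_nonneg_of_le_pi (by linarith) hy.2 hy.1
  have e1 := integral_line_hankelKernel_eq (x := x) (c := -Real.cos φ) (a := φ) (b := Real.pi) hx (by linarith)
    (by rw [uIcc_of_le h2.le]; exact hcos)
  have e2 := integral_line_hankelKernel_eq (x := x) (c := -Real.cos φ) (a := -φ) (b := -Real.pi) hx (by linarith)
    (by
      rw [uIcc_of_ge (by linarith)]
      intro y hy
      rw [← Real.cos_neg y]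
      exact hcos _ ⟨by linarith [hy.2], by linarith [hy.1]⟩)
  rw [hankelIntegral_eq_sub_integral_line hx (by linarith) hc, e1, e2,
    integral_line_of_exp_eq hx (by simp [Complex.exp_pi_mul_I]),
    integral_line_of_exp_eq hx (by simp [Complex.exp_neg, Complex.exp_pi_mul_I])]
  have hG := Complex.Gamma_mul_Gamma_one_sub x
  have hG1 : Complex.Gamma (1 - x) ≠ 0 := by
    apply Complex.Gamma_ne_zero_of_re_pos
    simpa using hx
  have hπc : (Real.pi : ℂ) ≠ 0 := by exact_mod_cast hπ.ne'
  have hs : (Complex.Gamma x)⁻¹ = Complex.sin (Real.pi * x) / Real.pi * Complex.Gamma (1 - x) := by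
    rw [eq_div_of_mul_eq hG1 hG]
    field_simp
  have hs2 : Complex.sin (Real.pi * x) = Complex.sin ((1 - x) * Real.pi) := by
    rw [← Complex.sin_pi_sub]; ring_nf
  rw [hs, hs2, Complex.sin]
  field_simp
  push_cast
  ring_nf
  rw [Complex.I_sq]
  ring_nf

/-- A path `w` in the closed right half-plane along which `exp (exp w)` decays fast enough to
absorb the factors `exp (K w)` and `exp (Z exp (σ w))`. -/
structure IsHankelPath (σ : ℝ) (μ : Measure ℝ) (w : ℝ → ℂ) : Prop where
  continuous : Continuous w
  re_nonneg : ∀ᵐ u ∂μ, 0 ≤ (w u).re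
  integrable : ∀ K Z : ℝ, Integrable (fun u =>
    Real.exp ((Complex.exp (w u)).re + K * (w u).re + Z * Real.exp (σ * (w u).re))) μ

lemma isHankelPath_arc (σ φ : ℝ) :
    IsHankelPath σ (volume.restrict (Icc (-φ) φ)) (fun y => y * Complex.I) where
  continuous := by fun_prop
  re_nonneg := ae_of_all _ fun y => by simp
  integrable K Z := by
    refine Continuous.integrableOn_Icc ?_
    exact Real.continuous_exp.comp (by fun_prop)

lemma isHankelPath_ray {σ ψ : ℝ} (hσ : σ ≤ 1 / 2) (hψ : Real.cos ψ < 0) :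
    IsHankelPath σ (volume.restrict (Ioi 0)) (fun r => r + ψ * Complex.I) where
  continuous := by fun_prop
  re_nonneg := (ae_restrict_iff' measurableSet_Ioi).2 <| ae_of_all _ fun r hr => by
    simpa using (mem_Ioi.1 hr).le
  integrable K Z := by
    set c := -Real.cos ψ with hc
    have hc0 : 0 < c := by linarith
    have h := ((integrable_exp_neg_mul_exp (c := c / 2) (y := max K 1) (by linarith)
      (by positivity)).const_mul (Real.exp (Z ^ 2 / (2 * c)))).integrableOn (s := Ioi 0)
    refine h.mono' (Continuous.aestronglyMeasurable (Real.continuous_exp.comp (by fun_prop))) ?_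
    refine (ae_restrict_iff' measurableSet_Ioi).2 <| ae_of_all _ fun r hr => ?_
    have hr' : 0 < r := hr
    rw [Real.norm_eq_abs, Real.abs_exp, ← Real.exp_add]
    apply Real.exp_le_exp.2
    have e1 : (Complex.exp (r + ψ * Complex.I)).re = -c * Real.exp r := by
      rw [Complex.exp_re]; simp [hc]; ring
    have e2 : ((r : ℂ) + ψ * Complex.I).re = r := by simp
    rw [e1, e2]
    have h1 : K * r ≤ max K 1 * r := by gcongr; exact le_max_left _ _
    have h2 : Z * Real.exp (σ * r) ≤ |Z| * Real.exp (r / 2) := by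
      gcongr
      · exact le_abs_self Z
      · nlinarith
    have h3 : |Z| * Real.exp (r / 2) ≤ c / 2 * Real.exp r + Z ^ 2 / (2 * c) := by
      have e : Real.exp r = Real.exp (r / 2) ^ 2 := by
        rw [← Real.exp_nat_mul]; congr 1; push_cast; ring
      have : c / 2 * Real.exp r + Z ^ 2 / (2 * c) - |Z| * Real.exp (r / 2) =
          (c * Real.exp (r / 2) - |Z|) ^ 2 / (2 * c) := by
        rw [e, ← sq_abs Z]; field_simp; ring
      have : 0 ≤ (c * Real.exp (r / 2) - |Z|) ^ 2 / (2 * c) := by positivity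
      linarith
    linarith

namespace IsHankelPath

variable {σ : ℝ} {μ : Measure ℝ} {w : ℝ → ℂ}

lemma integrable_hankelKernel (h : IsHankelPath σ μ w) (x : ℝ) :
    Integrable (fun u => hankelKernel x (w u)) μ := by
  have := h.continuous
  refine (h.integrable (1 - x) 0).mono' (by fun_prop) (ae_of_all _ fun u => ?_)
  rw [norm_hankelKernel]
  simp

lemma continuousWithinAt_integral (h : IsHankelPath σ μ w) :
    ContinuousWithinAt (fun x => ∫ u, hankelKernel x (w u) ∂μ) (Iio 1) 1 := by
  have hw := h.continuous
  refine continuousWithinAt_of_dominated (Eventually.of_forall fun x => by fun_prop) ?_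
    (h.integrable 1 0) (ae_of_all _ fun u => ?_)
  · filter_upwards [mem_nhdsWithin_of_mem_nhds (lt_mem_nhds one_pos)] with x hx
    filter_upwards [h.re_nonneg] with u hu
    rw [norm_hankelKernel, zero_mul, add_zero]
    gcongr
    linarith
  · unfold hankelKernel
    fun_prop

lemma hasSum_integral (h : IsHankelPath σ μ w) (ε : ℝ) (z : ℂ) :
    HasSum (fun m : ℕ => z ^ m / m.factorial * ∫ u, hankelKernel (ε - σ * m) (w u) ∂μ)
      (∫ u, hankelKernel ε (w u) * Complex.exp (z * Complex.exp (σ * w u)) ∂μ) := by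
  have hw := h.continuous
  have key : ∀ (m : ℕ) (u : ℝ), z ^ m / m.factorial * hankelKernel (ε - σ * m) (w u) =
      hankelKernel ε (w u) * ((z * Complex.exp (σ * w u)) ^ m / m.factorial) := by
    intro m u
    rw [mul_pow, ← Complex.exp_nat_mul, hankelKernel, hankelKernel,
      show Complex.exp (w u) + (1 - ((ε - σ * m : ℝ) : ℂ)) * w u =
        (Complex.exp (w u) + (1 - ε) * w u) + m * (σ * w u) by push_cast; ring, Complex.exp_add]
    ring
  have hsum : ∀ v : ℂ, HasSum (fun m : ℕ => v ^ m / m.factorial) (Complex.exp v) := fun v => by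
    rw [Complex.exp_eq_exp_ℂ]; exact NormedSpace.expSeries_div_hasSum_exp v
  have hbound : ∀ u, HasSum (fun m : ℕ => ‖z ^ m / m.factorial * hankelKernel (ε - σ * m) (w u)‖)
      (Real.exp ((Complex.exp (w u)).re + (1 - ε) * (w u).re +
        ‖z‖ * Real.exp (σ * (w u).re))) := by
    intro u
    have : HasSum (fun m : ℕ => (‖z * Complex.exp (σ * w u)‖) ^ m / m.factorial)
        (Real.exp ‖z * Complex.exp (σ * w u)‖) := by
      rw [Real.exp_eq_exp_ℝ]; exact NormedSpace.expSeries_div_hasSum_exp _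
    convert! this.mul_left ‖hankelKernel ε (w u)‖ using 1
    · ext m
      rw [key]
      simp
    · rw [norm_hankelKernel, ← Real.exp_add, norm_mul, Complex.norm_exp]
      simp
  simp_rw [← integral_const_mul]
  refine hasSum_integral_of_dominated_convergence
    (fun (m : ℕ) u => ‖z ^ m / m.factorial * hankelKernel (ε - σ * m) (w u)‖)
    (fun m => by fun_prop) (fun m => ae_of_all _ fun u => le_rfl)
    (ae_of_all _ fun u => (hbound u).summable) ?_ (ae_of_all _ fun u => ?_)
  · simp_rw [fun u => (hbound u).tsum_eq]
    exact h.integrable _ _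
  · simp_rw [key]
    exact (hsum _).mul_left _

lemma integrable_prod [SFinite μ] (h : IsHankelPath σ μ w) (ε : ℝ) {q : ℂ} {c : ℝ} (hc : 0 < c)
    (hq : ∀ᵐ u ∂μ, c ≤ (q * Complex.exp (σ * w u)).re) :
    Integrable (Function.uncurry fun (t u : ℝ) =>
      hankelKernel ε (w u) * Complex.exp (-q * t * Complex.exp (σ * w u)))
      ((volume.restrict (Ioi 0)).prod μ) := by
  have hw := h.continuous
  have hexp : IntegrableOn (fun t : ℝ => Real.exp (-c * t)) (Ioi 0) :=
    integrableOn_exp_mul_Ioi (by linarith) 0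
  refine (hexp.mul_prod (h.integrable_hankelKernel ε).norm).mono'
    (Continuous.aestronglyMeasurable (by unfold Function.uncurry; fun_prop)) ?_
  filter_upwards [Measure.quasiMeasurePreserving_fst.ae (ae_restrict_mem measurableSet_Ioi),
    Measure.quasiMeasurePreserving_snd.ae hq] with p ht hu
  rw [Function.uncurry, norm_mul, mul_comm, Complex.norm_exp,
    show -q * p.1 * Complex.exp (σ * w p.2) = ((-p.1 : ℝ) : ℂ) * (q * Complex.exp (σ * w p.2)) by
      push_cast; ring, Complex.re_ofReal_mul]
  have : 0 < p.1 := ht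
  exact mul_le_mul_of_nonneg_right (Real.exp_le_exp.2 (by nlinarith)) (norm_nonneg _)

lemma integral_integral [SFinite μ] (h : IsHankelPath σ μ w) (ε : ℝ) {q : ℂ} {c : ℝ} (hc : 0 < c)
    (hq : ∀ᵐ u ∂μ, c ≤ (q * Complex.exp (σ * w u)).re) (hq0 : q ≠ 0) :
    q * ∫ t in Ioi (0 : ℝ), ∫ u,
      hankelKernel ε (w u) * Complex.exp (-q * t * Complex.exp (σ * w u)) ∂μ =
    ∫ u, hankelKernel (ε + σ) (w u) ∂μ := by
  rw [integral_integral_swap (h.integrable_prod ε hc hq), ← integral_const_mul]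
  refine integral_congr_ae ?_
  filter_upwards [hq] with u hu
  have := integral_exp_mul_complex_Ioi (a := -(q * Complex.exp (σ * w u)))
    (by rw [Complex.neg_re]; linarith) 0
  rw [integral_const_mul]
  simp_rw [show ∀ t : ℝ, -q * t * Complex.exp (σ * w u) = -(q * Complex.exp (σ * w u)) * t from
    fun t => by ring]
  have hk : hankelKernel ε (w u) = hankelKernel (ε + σ) (w u) * Complex.exp (σ * w u) := by
    rw [hankelKernel, hankelKernel, ← Complex.exp_add]; push_cast; ring_nf
  have he := Complex.exp_ne_zero (σ * w u)
  rw [this, hk]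
  simp
  field_simp

end IsHankelPath

lemma hasDerivAt_hankelKernel (x : ℝ) (w : ℂ) :
    HasDerivAt (hankelKernel (x + 1)) (hankelKernel x w - x * hankelKernel (x + 1) w) w := by
  have h : HasDerivAt (fun w : ℂ => Complex.exp w + (1 - ((x + 1 : ℝ) : ℂ)) * w)
      (Complex.exp w + (1 - ((x + 1 : ℝ) : ℂ)) * 1) w :=
    (Complex.hasDerivAt_exp w).add ((hasDerivAt_id w).const_mul _)
  have hk : hankelKernel x w = hankelKernel (x + 1) w * Complex.exp w := by
    rw [hankelKernel, hankelKernel, ← Complex.exp_add]; push_cast; ring_nf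
  convert! h.cexp using 1
  rw [hk, hankelKernel]
  push_cast
  ring

lemma integral_ray_sub {ψ : ℝ} (hψ : Real.cos ψ < 0) (x : ℝ) :
    (∫ r in Ioi (0 : ℝ), hankelKernel x (r + ψ * Complex.I)) -
      x * (∫ r in Ioi (0 : ℝ), hankelKernel (x + 1) (r + ψ * Complex.I)) =
    -hankelKernel (x + 1) (ψ * Complex.I) := by
  have hp := isHankelPath_ray (σ := 0) (by norm_num) hψ
  have hi := hp.integrable_hankelKernel x
  have hi' := (hp.integrable_hankelKernel (x + 1)).const_mul (x : ℂ)
  rw [← integral_const_mul, ← integral_sub hi hi']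
  refine (integral_Ioi_of_hasDerivAt_of_tendsto' (m := 0)
    (f := fun r : ℝ => hankelKernel (x + 1) (r + ψ * Complex.I)) (fun r _ => ?_)
    (hi.sub hi') ?_).trans (by simp)
  · exact HasDerivAt.comp_ofReal (e := fun v : ℂ => hankelKernel (x + 1) (v + ψ * Complex.I))
      ((hasDerivAt_hankelKernel x _).comp_add_const _ _)
  · refine squeeze_zero_norm (fun r => norm_hankelKernel_le (c := -Real.cos ψ) (by simp) r)
      (tendsto_exp_neg_mul_exp_atTop (by linarith) _)

lemma integral_arc_sub {φ : ℝ} (hφ : 0 ≤ φ) (x : ℝ) :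
    Complex.I * (∫ y in Icc (-φ) φ, hankelKernel x (y * Complex.I)) -
      x * (Complex.I * ∫ y in Icc (-φ) φ, hankelKernel (x + 1) (y * Complex.I)) =
    hankelKernel (x + 1) (φ * Complex.I) - hankelKernel (x + 1) ((-φ : ℝ) * Complex.I) := by
  rw [integral_Icc_eq_integral_Ioc, ← intervalIntegral.integral_of_le (by linarith),
    integral_Icc_eq_integral_Ioc, ← intervalIntegral.integral_of_le (by linarith),
    ← intervalIntegral.integral_eq_sub_of_hasDerivAt (a := -φ) (b := φ)
      (f := fun y : ℝ => hankelKernel (x + 1) (y * Complex.I))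
      (f' := fun y : ℝ => (hankelKernel x (y * Complex.I) -
        x * hankelKernel (x + 1) (y * Complex.I)) * Complex.I) _
      (Continuous.intervalIntegrable (by fun_prop) _ _),
    intervalIntegral.integral_mul_const, intervalIntegral.integral_sub
      (Continuous.intervalIntegrable (by fun_prop) _ _)
      (Continuous.intervalIntegrable (by fun_prop) _ _), intervalIntegral.integral_const_mul]
  · ring
  · intro y _
    have h : HasDerivAt (fun v : ℂ => v * Complex.I) Complex.I (y : ℂ) := by
      simpa using (hasDerivAt_id (y : ℂ)).mul_const Complex.I
    exact ((hasDerivAt_hankelKernel x _).comp (y : ℂ) h).comp_ofReal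

lemma hankelIntegral_eq_mul {φ : ℝ} (hφ : 0 ≤ φ) (hc : Real.cos φ < 0) (x : ℝ) :
    hankelIntegral φ (hankelKernel x) = x * hankelIntegral φ (hankelKernel (x + 1)) := by
  have h1 := integral_ray_sub hc x
  have h2 := integral_ray_sub (ψ := -φ) (by simpa using hc) x
  have h3 := integral_arc_sub hφ x
  unfold hankelIntegral
  linear_combination h1 - h2 + h3

/-- Hankel's formula for the reciprocal of the Gamma function. -/
theorem hankelIntegral_hankelKernel {φ : ℝ} (h1 : Real.pi / 2 < φ) (h2 : φ < Real.pi) (x : ℝ) :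
    hankelIntegral φ (hankelKernel x) = 2 * Real.pi * Complex.I * (Complex.Gamma x)⁻¹ := by
  have hφ : 0 ≤ φ := by linarith [Real.pi_pos]
  have hc : Real.cos φ < 0 := Real.cos_neg_of_pi_div_two_lt_of_lt h1 (by linarith [Real.pi_pos])
  have hone : hankelIntegral φ (hankelKernel 1) =
      2 * Real.pi * Complex.I * (Complex.Gamma (1 : ℝ))⁻¹ := by
    have hl : ContinuousWithinAt (fun x => hankelIntegral φ (hankelKernel x)) (Iio 1) 1 :=
      ((continuousWithinAt_const.mul (isHankelPath_arc 0 φ).continuousWithinAt_integral).add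
        (isHankelPath_ray (σ := 0) (by norm_num) hc).continuousWithinAt_integral).sub
        (isHankelPath_ray (σ := 0) (ψ := -φ) (by norm_num)
          (by simpa using hc)).continuousWithinAt_integral
    have hr : Continuous fun x : ℝ => 2 * Real.pi * Complex.I * (Complex.Gamma x)⁻¹ :=
      continuous_const.mul
        (Complex.differentiable_one_div_Gamma.continuous.comp Complex.continuous_ofReal)
    refine tendsto_nhds_unique hl.tendsto (hr.continuousWithinAt.tendsto.congr' ?_)
    filter_upwards [self_mem_nhdsWithin] with x hx
    exact (hankelIntegral_of_lt_one hx h1 h2).symm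
  have main : ∀ (m : ℕ) (x : ℝ), x < m + 1 →
      hankelIntegral φ (hankelKernel x) = 2 * Real.pi * Complex.I * (Complex.Gamma x)⁻¹ := by
    intro m
    induction m with
    | zero => intro x hx; exact hankelIntegral_of_lt_one (by simpa using hx) h1 h2
    | succ m ih =>
      intro x hx
      rcases eq_or_ne x 1 with rfl | hx1
      · exact hone
      · have h := ih (x - 1) (by push_cast at hx; linarith)
        have hx0 : ((x - 1 : ℝ) : ℂ) ≠ 0 := by exact_mod_cast sub_ne_zero.2 hx1
        rw [hankelIntegral_eq_mul hφ hc, Complex.one_div_Gamma_eq_self_mul_one_div_Gamma_add_one,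
          sub_add_cancel, show ((x - 1 : ℝ) : ℂ) + 1 = x by push_cast; ring] at h
        apply mul_left_cancel₀ hx0
        linear_combination h
  obtain ⟨m, hm⟩ := exists_nat_gt x
  exact main m x (by linarith)

lemma wrightPhi_eq_hankelIntegral {σ φ : ℝ} (hσ : σ ≤ 1 / 2) (h1 : Real.pi / 2 < φ)
    (h2 : φ < Real.pi) (ε : ℝ) (z : ℂ) :
    2 * Real.pi * Complex.I * wrightPhi σ ε z = hankelIntegral φ (fun w =>
      hankelKernel ε w * Complex.exp (z * Complex.exp (σ * w))) := by
  have hc : Real.cos φ < 0 := Real.cos_neg_of_pi_div_two_lt_of_lt h1 (by linarith [Real.pi_pos])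
  have hs := ((((isHankelPath_arc σ φ).hasSum_integral ε z).mul_left Complex.I).add
    ((isHankelPath_ray hσ hc).hasSum_integral ε z)).sub
    ((isHankelPath_ray (ψ := -φ) hσ (by simpa using hc)).hasSum_integral ε z)
  rw [hankelIntegral, ← hs.tsum_eq, wrightPhi, ← tsum_mul_left]
  congr 1
  ext m
  have h := hankelIntegral_hankelKernel h1 h2 (ε - σ * m)
  rw [hankelIntegral] at h
  rw [show -(σ : ℂ) * m + ε = ((ε - σ * m : ℝ) : ℂ) by push_cast; ring, div_mul_eq_div_div,
    div_eq_mul_inv _ (Complex.Gamma _)]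
  linear_combination (-z ^ m / m.factorial) * h

/-- `φ(-σ, ε, -qt)` is integrable over `t > 0`, with integral `1 / (q Γ(ε + σ))`, when `q = e^{iθ}`
and `|θ| < (1 - σ)π/2`. -/
theorem integral_wrightPhi_ray {σ θ : ℝ} (hσ0 : 0 ≤ σ) (hσ : σ ≤ 1 / 2)
    (hθ : |θ| + σ * (Real.pi / 2) < Real.pi / 2) (ε : ℝ) :
    IntegrableOn (fun t : ℝ => wrightPhi σ ε (-Complex.exp (Complex.I * θ) * t)) (Ioi 0) ∧
      Complex.exp (Complex.I * θ) *
        ∫ t in Ioi (0 : ℝ), wrightPhi σ ε (-Complex.exp (Complex.I * θ) * t) =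
      (Complex.Gamma ((ε + σ : ℝ) : ℂ))⁻¹ := by
  have hπ := Real.pi_pos
  obtain ⟨φ, h1, h2, hφ⟩ : ∃ φ, Real.pi / 2 < φ ∧ φ < Real.pi ∧ |θ| + σ * φ < Real.pi / 2 := by
    set δ := Real.pi / 2 - (|θ| + σ * (Real.pi / 2)) with hδ
    have hδ1 : δ ≤ Real.pi / 2 := by
      have : 0 ≤ |θ| + σ * (Real.pi / 2) := by positivity
      linarith
    refine ⟨Real.pi / 2 + δ / 2, by linarith, by linarith, by nlinarith⟩
  have hc : Real.cos φ < 0 := Real.cos_neg_of_pi_div_two_lt_of_lt h1 (by linarith)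
  have hφ0 : 0 ≤ φ := by linarith
  set q := Complex.exp (Complex.I * θ) with hqdef
  set c := Real.cos (|θ| + σ * φ) with hcdef
  have hc0 : 0 < c := Real.cos_pos_of_mem_Ioo
    ⟨by have : 0 ≤ |θ| + σ * φ := by positivity
        linarith, hφ⟩
  have hre : ∀ r y : ℝ, 0 ≤ r → |y| ≤ φ →
      c ≤ (q * Complex.exp (σ * (r + y * Complex.I))).re := by
    intro r y hr hy
    have hcos : c ≤ Real.cos (θ + σ * y) := by
      rw [← Real.cos_abs (θ + σ * y)]
      refine Real.cos_le_cos_of_nonneg_of_le_pi (abs_nonneg _) (by linarith) ?_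
      refine (abs_add_le _ _).trans ?_
      rw [abs_mul, abs_of_nonneg hσ0]
      gcongr
    have e : (q * Complex.exp (σ * (r + y * Complex.I))).re =
        Real.exp (σ * r) * Real.cos (θ + σ * y) := by
      rw [hqdef, ← Complex.exp_add, Complex.exp_re]
      simp
    rw [e]
    have : 1 ≤ Real.exp (σ * r) := Real.one_le_exp (by positivity)
    nlinarith
  have q1 : ∀ᵐ y : ℝ ∂(volume.restrict (Icc (-φ) φ)),
      c ≤ (q * Complex.exp (σ * (y * Complex.I))).re := by
    filter_upwards [ae_restrict_mem measurableSet_Icc] with y hy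
    simpa using hre 0 y le_rfl (abs_le.2 hy)
  have q2 : ∀ ψ : ℝ, |ψ| ≤ φ → ∀ᵐ r : ℝ ∂(volume.restrict (Ioi (0 : ℝ))),
      c ≤ (q * Complex.exp (σ * (r + ψ * Complex.I))).re := by
    intro ψ hψ
    filter_upwards [ae_restrict_mem measurableSet_Ioi] with r hr
    exact hre r ψ (mem_Ioi.1 hr).le hψ
  have q3 := q2 φ (abs_of_nonneg hφ0).le
  have q4 := q2 (-φ) (by rw [abs_neg, abs_of_nonneg hφ0])
  have p1 := isHankelPath_arc σ φ
  have p3 := isHankelPath_ray hσ hc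
  have p4 := isHankelPath_ray (ψ := -φ) hσ (by simpa using hc)
  have i1 := (p1.integrable_prod ε hc0 q1).integral_prod_left.const_mul Complex.I
  have i3 := (p3.integrable_prod ε hc0 q3).integral_prod_left
  have i4 := (p4.integrable_prod ε hc0 q4).integral_prod_left
  have hq0 : q ≠ 0 := Complex.exp_ne_zero _
  have hc2 : 2 * Real.pi * Complex.I ≠ 0 := Complex.two_pi_I_ne_zero
  have heq : (fun t : ℝ => wrightPhi σ ε (-q * t)) = fun t : ℝ =>
      (2 * Real.pi * Complex.I)⁻¹ * hankelIntegral φ (fun w =>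
        hankelKernel ε w * Complex.exp (-q * t * Complex.exp (σ * w))) := by
    ext t
    rw [← wrightPhi_eq_hankelIntegral hσ h1 h2, inv_mul_cancel_left₀ hc2]
  rw [heq]
  refine ⟨((i1.add i3).sub i4).const_mul _, ?_⟩
  have hH := hankelIntegral_hankelKernel h1 h2 (ε + σ)
  rw [integral_const_mul]
  simp only [hankelIntegral] at hH ⊢
  have hsplit := integral_sub (i1.add i3) i4
  have hsplit' := integral_add i1 i3
  simp only [Function.uncurry, Pi.add_apply] at hsplit hsplit'
  rw [hsplit, hsplit', integral_const_mul]
  have j1 := p1.integral_integral ε hc0 q1 hq0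
  have j3 := p3.integral_integral ε hc0 q3 hq0
  have j4 := p4.integral_integral ε hc0 q4 hq0
  rw [← j1, ← j3, ← j4] at hH
  rw [← inv_mul_cancel_left₀ hc2 (Complex.Gamma _)⁻¹, ← hH]
  ring

end Wright

/-- The improper integral `∫_0^∞ φ(-σ, ε, -e^{iθ_k} t) dt` (with `σ = α/(2n)`) converges
and `e^{iθ_k} ∫_0^∞ φ(-σ, ε, -e^{iθ_k} t) dt = 1/Γ(ε + σ)`. -/
theorem wright_integral_ray (n : ℕ) (hn : 2 ≤ n) (α : ℝ) (hα1 : 1 < α) (hα2 : α < 2)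
    (k : ℕ) (hk : k < n) (ε : ℝ) :
    MeasureTheory.IntegrableOn
      (fun t : ℝ =>
        wrightPhi (α / (2 * n)) ε (-Complex.exp (Complex.I * (thetaK n k : ℂ)) * (t : ℂ)))
      (Set.Ioi (0 : ℝ)) ∧
    Complex.exp (Complex.I * (thetaK n k : ℂ)) *
        ∫ t in Set.Ioi (0 : ℝ),
          wrightPhi (α / (2 * n)) ε (-Complex.exp (Complex.I * (thetaK n k : ℂ)) * (t : ℂ))
      = 1 / Complex.Gamma ((ε : ℂ) + (α / (2 * n) : ℝ)) := by
  have hn' : (2 : ℝ) ≤ n := by exact_mod_cast hn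
  have hk' : (k : ℝ) + 1 ≤ n := by exact_mod_cast hk
  have hk0 : (0 : ℝ) ≤ k := Nat.cast_nonneg k
  have hn0 : (0 : ℝ) < n := by linarith
  have hπ := Real.pi_pos
  have hσ : α / (2 * n) < 1 / n := by
    rw [div_lt_div_iff₀ (by positivity) hn0]
    nlinarith
  have hθ : |thetaK n k| ≤ Real.pi / 2 * (1 - 1 / n) := by
    have e : thetaK n k = Real.pi / 2 * ((n - 1 - 2 * k) / n) := by
      rw [thetaK]; field_simp
    have e' : 1 - 1 / (n : ℝ) = (n - 1) / n := by field_simp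
    rw [e, e', abs_mul, abs_of_pos (by positivity), abs_div, abs_of_pos hn0]
    gcongr
    rw [abs_le]
    constructor <;> linarith
  have hσ2 : α / (2 * n) ≤ 1 / 2 :=
    hσ.le.trans (one_div_le_one_div_of_le two_pos hn')
  have h := Wright.integral_wrightPhi_ray (σ := α / (2 * n)) (θ := thetaK n k)
    (by positivity) hσ2 (by nlinarith) ε
  rw [one_div, ← Complex.ofReal_add]
  exact h
end
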